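/- Fix h ∈ C and a function f : Z → C, and let C(sl2,h,f) be the category of Z-graded complex vector spaces with operators x, y as below. For every simple object V of C(sl2,h,f) whose underlying vector space is finite-dimensional, there is an isomorphism of graded C-algebras Ext^•_{C(sl2,h,f)}(V,V) ≅ C[t]/(t^2), where t has degree 2; equivalently, Ext^•(V,V) is isomorphic as a graded algebra to H^•(P^1(C), C), the cohomology of the flag variety of sl(2,C). -/

import Mathlib

/-!
For `h ∈ ℂ` and `f : ℤ → ℂ`, the category `C(sl2, h, f)` has as objects ℤ-graded complex
vector spaces `V = ⊕ₙ V(n)` with endomorphisms `x`, `y` satisfying `x·V(n) ⊆ V(n+1)`,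
`y·V(n) ⊆ V(n-1)` and `[x,y]v = f(n)·v` for `v ∈ V(n)` (the quantum Serre relations are
vacuous for `sl₂`, so `h` does not enter the definition); morphisms are grading-preserving
linear maps commuting with `x` and `y`.  We state: for every simple object `V` of
`C(sl2,h,f)` whose underlying vector space is finite dimensional, the Yoneda Ext-algebra
`Ext^•(V,V)` is isomorphic, as a graded ℂ-algebra, to `ℂ[t]/(t²) = H^•(ℙ¹(ℂ), ℂ)` with `t`
in degree 2.  (The algebra `ℂ[t]/(t²)` is realized as the dual numbers `ℂ[ε]`.)
-/

open CategoryTheory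

/-- An object of the category `C(sl2, h, f)`: a ℤ-graded complex vector space with
operators `x`, `y` shifting the grading by `+1`, `-1`, with `[x,y] = f(n)` on `V(n)`. -/
structure CSl2Obj (f : ℤ → ℂ) : Type 1 where
  carrier : Type
  [isAddCommGroup : AddCommGroup carrier]
  [isModule : Module ℂ carrier]
  grading : ℤ → Submodule ℂ carrier
  internal : DirectSum.IsInternal grading
  x : carrier →ₗ[ℂ] carrier
  y : carrier →ₗ[ℂ] carrier
  x_mem : ∀ (n : ℤ), ∀ v ∈ grading n, x v ∈ grading (n + 1)
  y_mem : ∀ (n : ℤ), ∀ v ∈ grading n, y v ∈ grading (n - 1)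
  comm : ∀ (n : ℤ), ∀ v ∈ grading n, x (y v) - y (x v) = f n • v

attribute [instance] CSl2Obj.isAddCommGroup CSl2Obj.isModule

/-- A morphism in the category `C(sl2, h, f)`: a linear map preserving the grading and
commuting with `x` and `y`. -/
@[ext]
structure CSl2Hom {f : ℤ → ℂ} (M N : CSl2Obj f) where
  toLinearMap : M.carrier →ₗ[ℂ] N.carrier
  map_grading : ∀ (n : ℤ), ∀ v ∈ M.grading n, toLinearMap v ∈ N.grading n
  comm_x : ∀ v, toLinearMap (M.x v) = N.x (toLinearMap v)
  comm_y : ∀ v, toLinearMap (M.y v) = N.y (toLinearMap v)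

instance CSl2.instCategory (f : ℤ → ℂ) : Category (CSl2Obj f) where
  Hom M N := CSl2Hom M N
  id M := ⟨LinearMap.id, fun _ _ hv => hv, fun _ => rfl, fun _ => rfl⟩
  comp φ ψ := ⟨ψ.toLinearMap ∘ₗ φ.toLinearMap,
    fun n v hv => ψ.map_grading n _ (φ.map_grading n v hv),
    fun v => by simp [φ.comm_x, ψ.comm_x],
    fun v => by simp [φ.comm_y, ψ.comm_y]⟩
  id_comp φ := CSl2Hom.ext (LinearMap.comp_id _)
  comp_id φ := CSl2Hom.ext (LinearMap.id_comp _)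
  assoc φ ψ χ := CSl2Hom.ext rfl

/-- The scalar endomorphism `c • id` of an object of `C(sl2, h, f)`; it encodes the
ℂ-linear structure of the category. -/
def CSl2.scalarHom {f : ℤ → ℂ} (c : ℂ) (M : CSl2Obj f) : M ⟶ M :=
  ⟨c • LinearMap.id,
    fun n v hv => (M.grading n).smul_mem c hv,
    fun v => by simp,
    fun v => by simp⟩

/-- The degree-`n` graded component of `H^•(ℙ¹(ℂ), ℂ) = ℂ[t]/(t²)`, `t` in degree `2`,
realized inside the algebra `ℂ[ε] = ℂ[t]/(t²)` of dual numbers: `ℂ·1` in degree 0,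
`ℂ·ε` in degree 2, and `0` in every other degree. -/
noncomputable def P1CohomologyPiece (n : ℕ) : Submodule ℂ (DualNumber ℂ) :=
  if n = 0 then Submodule.span ℂ {1}
  else if n = 2 then Submodule.span ℂ {(DualNumber.eps : DualNumber ℂ)}
  else ⊥

namespace CSl2

open CategoryTheory.Abelian CategoryTheory.Limits

variable {f : ℤ → ℂ}

/-! ### Gradings -/

theorem isInternal_of_projections {M : Type} [AddCommGroup M] [Module ℂ M]
    (A : ℤ → Submodule ℂ M) (p : ℤ → M →ₗ[ℂ] M)
    (hsame : ∀ n, ∀ v ∈ A n, p n v = v)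
    (hne : ∀ m n, m ≠ n → ∀ v ∈ A m, p n v = 0)
    (htop : ∀ v, v ∈ ⨆ n, A n) : DirectSum.IsInternal A := by
  rw [DirectSum.isInternal_submodule_iff_iSupIndep_and_iSup_eq_top]
  refine ⟨fun n => ?_, eq_top_iff.2 fun v _ => htop v⟩
  rw [Submodule.disjoint_def]
  intro v hv hv'
  have hle : (⨆ j, ⨆ (_ : j ≠ n), A j) ≤ LinearMap.ker (p n) :=
    iSup₂_le fun j hj w hw => hne j n hj w hw
  rw [← hsame n v hv]
  exact hle hv'

/-- The projection of `M` onto its homogeneous component of degree `n`. -/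
noncomputable def proj (M : CSl2Obj f) (n : ℤ) : M.carrier →ₗ[ℂ] M.carrier :=
  letI := M.internal.chooseDecomposition
  (M.grading n).subtype ∘ₗ DirectSum.component ℂ ℤ _ n ∘ₗ
    (DirectSum.decomposeLinearEquiv M.grading).toLinearMap

theorem proj_mem (M : CSl2Obj f) (n : ℤ) (v : M.carrier) : proj M n v ∈ M.grading n :=
  Subtype.prop _

theorem proj_same {M : CSl2Obj f} {n : ℤ} {v : M.carrier} (hv : v ∈ M.grading n) :
    proj M n v = v :=
  let := M.internal.chooseDecomposition
  DirectSum.decompose_of_mem_same M.grading hv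

theorem proj_ne {M : CSl2Obj f} {m n : ℤ} (h : m ≠ n) {v : M.carrier} (hv : v ∈ M.grading m) :
    proj M n v = 0 :=
  let := M.internal.chooseDecomposition
  DirectSum.decompose_of_mem_ne M.grading hv h

theorem iSup_grading (M : CSl2Obj f) : ⨆ n, M.grading n = ⊤ :=
  M.internal.submodule_iSup_eq_top

theorem exists_eq_sum_proj (M : CSl2Obj f) (v : M.carrier) :
    ∃ s : Finset ℤ, v = ∑ n ∈ s, proj M n v := by
  classical
  let := M.internal.chooseDecomposition
  exact ⟨_, (DirectSum.sum_support_decompose M.grading v).symm⟩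

theorem linearMap_ext {M : CSl2Obj f} {N : Type} [AddCommGroup N] [Module ℂ N]
    {φ ψ : M.carrier →ₗ[ℂ] N} (h : ∀ n, ∀ v ∈ M.grading n, φ v = ψ v) : φ = ψ := by
  have : (⨆ n, M.grading n) ≤ LinearMap.eqLocus φ ψ := iSup_le fun n v hv => h n v hv
  rw [iSup_grading] at this
  exact LinearMap.ext fun v => this trivial

/-- The linear map underlying a morphism. -/
def lin {M N : CSl2Obj f} (φ : M ⟶ N) : M.carrier →ₗ[ℂ] N.carrier := CSl2Hom.toLinearMap φ

@[simp]
theorem lin_comp {M N K : CSl2Obj f} (φ : M ⟶ N) (ψ : N ⟶ K) (v : M.carrier) :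
    lin (φ ≫ ψ) v = lin ψ (lin φ v) := rfl

@[simp]
theorem lin_id (M : CSl2Obj f) (v : M.carrier) : lin (𝟙 M) v = v := rfl

theorem lin_mem {M N : CSl2Obj f} (φ : M ⟶ N) {n : ℤ} {v : M.carrier} (hv : v ∈ M.grading n) :
    lin φ v ∈ N.grading n :=
  CSl2Hom.map_grading φ n v hv

theorem lin_x {M N : CSl2Obj f} (φ : M ⟶ N) (v : M.carrier) : lin φ (M.x v) = N.x (lin φ v) :=
  CSl2Hom.comm_x φ v

theorem lin_y {M N : CSl2Obj f} (φ : M ⟶ N) (v : M.carrier) : lin φ (M.y v) = N.y (lin φ v) :=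
  CSl2Hom.comm_y φ v

theorem lin_x_pow {M N : CSl2Obj f} (φ : M ⟶ N) (i : ℕ) (v : M.carrier) :
    lin φ ((M.x ^ i) v) = (N.x ^ i) (lin φ v) := by
  induction i with
  | zero => simp
  | succ i ih => simp only [pow_succ', Module.End.mul_apply, lin_x, ih]

theorem lin_y_pow {M N : CSl2Obj f} (φ : M ⟶ N) (i : ℕ) (v : M.carrier) :
    lin φ ((M.y ^ i) v) = (N.y ^ i) (lin φ v) := by
  induction i with
  | zero => simp
  | succ i ih => simp only [pow_succ', Module.End.mul_apply, lin_y, ih]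

theorem hom_ext {M N : CSl2Obj f} {φ ψ : M ⟶ N} (h : ∀ v, lin φ v = lin ψ v) : φ = ψ :=
  CSl2Hom.ext (LinearMap.ext h)

theorem lin_proj {M N : CSl2Obj f} (φ : M ⟶ N) (n : ℤ) (v : M.carrier) :
    lin φ (proj M n v) = proj N n (lin φ v) := by
  have : lin φ ∘ₗ proj M n = proj N n ∘ₗ lin φ := by
    refine linearMap_ext fun m v hv => ?_
    by_cases h : m = n
    · subst h
      simp [proj_same hv, proj_same (lin_mem φ hv)]
    · simp [proj_ne h hv, proj_ne h (lin_mem φ hv)]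
  exact LinearMap.congr_fun this v

theorem x_pow_mem (M : CSl2Obj f) {n : ℤ} {v : M.carrier} (hv : v ∈ M.grading n) (i : ℕ) :
    (M.x ^ i) v ∈ M.grading (n + i) := by
  induction i with
  | zero => simpa using hv
  | succ i ih =>
    rw [pow_succ', Module.End.mul_apply]
    simpa [add_assoc] using M.x_mem _ _ ih

theorem y_pow_mem (M : CSl2Obj f) {n : ℤ} {v : M.carrier} (hv : v ∈ M.grading n) (i : ℕ) :
    (M.y ^ i) v ∈ M.grading (n - i) := by
  induction i with
  | zero => simpa using hv
  | succ i ih =>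
    rw [pow_succ', Module.End.mul_apply]
    simpa [sub_sub] using M.y_mem _ _ ih

/-! ### Subobjects, squares, and the additive structure -/

/-- The subobject carried by a homogeneous stable submodule. -/
noncomputable abbrev subObj (M : CSl2Obj f) (S : Submodule ℂ M.carrier)
    (hp : ∀ n, ∀ v ∈ S, proj M n v ∈ S) (hx : ∀ v ∈ S, M.x v ∈ S) (hy : ∀ v ∈ S, M.y v ∈ S) :
    CSl2Obj f where
  carrier := S
  grading n := (M.grading n).comap S.subtype
  internal := by
    refine isInternal_of_projections _ (fun n => (proj M n).restrict (hp n))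
      (fun n v hv => Subtype.ext (proj_same hv))
      (fun m n hmn v hv => Subtype.ext (proj_ne hmn hv)) fun v => ?_
    obtain ⟨s, hs⟩ := exists_eq_sum_proj M v
    have : v = ∑ n ∈ s, (⟨proj M n v, hp n v v.2⟩ : S) :=
      Subtype.ext (by simpa using hs)
    rw [this]
    exact Submodule.sum_mem _ fun n _ =>
      Submodule.mem_iSup_of_mem n (proj_mem M n (v : M.carrier))
  x := M.x.restrict hx
  y := M.y.restrict hy
  x_mem n v hv := M.x_mem n v hv
  y_mem n v hv := M.y_mem n v hv
  comm n v hv := Subtype.ext (M.comm n v hv)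

/-- The square `M × M`. -/
noncomputable abbrev sqObj (M : CSl2Obj f) : CSl2Obj f where
  carrier := M.carrier × M.carrier
  grading n := (M.grading n).prod (M.grading n)
  internal := by
    refine isInternal_of_projections _ (fun n => (proj M n).prodMap (proj M n))
      (fun n v hv => Prod.ext (proj_same hv.1) (proj_same hv.2))
      (fun m n hmn v hv => Prod.ext (proj_ne hmn hv.1) (proj_ne hmn hv.2)) fun v => ?_
    have h : ∀ w : M.carrier, w ∈ ⨆ n, M.grading n := fun w => by simp [iSup_grading]
    have hl : (⨆ n, M.grading n) ≤ (⨆ n, (M.grading n).prod (M.grading n)).comap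
        (LinearMap.inl ℂ M.carrier M.carrier) :=
      iSup_le fun n w hw => Submodule.mem_iSup_of_mem n ⟨hw, zero_mem _⟩
    have hr : (⨆ n, M.grading n) ≤ (⨆ n, (M.grading n).prod (M.grading n)).comap
        (LinearMap.inr ℂ M.carrier M.carrier) :=
      iSup_le fun n w hw => Submodule.mem_iSup_of_mem n ⟨zero_mem _, hw⟩
    have hv : v = (v.1, 0) + (0, v.2) := by simp
    exact hv ▸ add_mem (hl (h v.1)) (hr (h v.2))
  x := M.x.prodMap M.x
  y := M.y.prodMap M.y
  x_mem n v hv := ⟨M.x_mem n _ hv.1, M.x_mem n _ hv.2⟩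
  y_mem n v hv := ⟨M.y_mem n _ hv.1, M.y_mem n _ hv.2⟩
  comm n v hv := Prod.ext (M.comm n _ hv.1) (M.comm n _ hv.2)

/-- The zero object. -/
noncomputable abbrev zeroObj (f : ℤ → ℂ) : CSl2Obj f where
  carrier := PUnit
  grading _ := ⊤
  internal := isInternal_of_projections _ 0 (fun _ _ _ => rfl) (fun _ _ _ _ _ => rfl)
    fun _ => Submodule.mem_iSup_of_mem 0 trivial
  x := 0
  y := 0
  x_mem _ _ _ := trivial
  y_mem _ _ _ := trivial
  comm _ _ _ := rfl

@[simp]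
theorem lin_zero [HasZeroMorphisms (CSl2Obj f)] {M N : CSl2Obj f} (v : M.carrier) :
    lin (0 : M ⟶ N) v = 0 := by
  rw [← zero_comp (X := M) (f := (0 : zeroObj f ⟶ N)), lin_comp,
    Subsingleton.elim (α := PUnit) (lin (0 : M ⟶ zeroObj f) v) 0, map_zero]

theorem eq_zero_of_lin [HasZeroMorphisms (CSl2Obj f)] {M N : CSl2Obj f} {φ : M ⟶ N}
    (h : ∀ v, lin φ v = 0) : φ = 0 :=
  hom_ext fun v => by simp [h]

@[simp]
theorem lin_add [Preadditive (CSl2Obj f)] {M N : CSl2Obj f} (φ ψ : M ⟶ N) (v : M.carrier) :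
    lin (φ + ψ) v = lin φ v + lin ψ v := by
  let fst : sqObj N ⟶ N := ⟨LinearMap.fst ℂ _ _, fun _ _ hv => hv.1, fun _ => rfl, fun _ => rfl⟩
  let snd : sqObj N ⟶ N := ⟨LinearMap.snd ℂ _ _, fun _ _ hv => hv.2, fun _ => rfl, fun _ => rfl⟩
  let inl : N ⟶ sqObj N := ⟨LinearMap.inl ℂ _ _, fun _ _ hv => ⟨hv, zero_mem _⟩,
    fun v => Prod.ext rfl (map_zero N.x).symm, fun v => Prod.ext rfl (map_zero N.y).symm⟩
  let inr : N ⟶ sqObj N := ⟨LinearMap.inr ℂ _ _, fun _ _ hv => ⟨zero_mem _, hv⟩,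
    fun v => Prod.ext (map_zero N.x).symm rfl, fun v => Prod.ext (map_zero N.y).symm rfl⟩
  let sum : sqObj N ⟶ N := ⟨LinearMap.fst ℂ _ _ + LinearMap.snd ℂ _ _,
    fun _ _ hv => add_mem hv.1 hv.2, fun v => (map_add N.x _ _).symm,
    fun v => (map_add N.y _ _).symm⟩
  let lift : M ⟶ sqObj N := ⟨(lin φ).prod (lin ψ), fun _ _ hv => ⟨lin_mem φ hv, lin_mem ψ hv⟩,
    fun v => Prod.ext (lin_x φ v) (lin_x ψ v), fun v => Prod.ext (lin_y φ v) (lin_y ψ v)⟩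
  have h₁ : inl ≫ fst = 𝟙 N := hom_ext fun v => rfl
  have h₂ : inr ≫ snd = 𝟙 N := hom_ext fun v => rfl
  have h₃ : inl ≫ snd = 0 := eq_zero_of_lin fun v => rfl
  have h₄ : inr ≫ fst = 0 := eq_zero_of_lin fun v => rfl
  have hid : fst ≫ inl + snd ≫ inr = 𝟙 (sqObj N) := by
    refine hom_ext fun v => Prod.ext ?_ ?_
    · change lin ((fst ≫ inl + snd ≫ inr) ≫ fst) v = lin fst v
      simp [h₁, h₄]
    · change lin ((fst ≫ inl + snd ≫ inr) ≫ snd) v = lin snd v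
      simp [h₂, h₃]
  have hf : lift ≫ fst = φ := hom_ext fun v => rfl
  have hs : lift ≫ snd = ψ := hom_ext fun v => rfl
  have hl : inl ≫ sum = 𝟙 N := hom_ext fun v => add_zero v
  have hr : inr ≫ sum = 𝟙 N := hom_ext fun v => zero_add v
  have key : lift ≫ sum = φ + ψ := by
    rw [← Category.comp_id lift, ← hid]
    simp [reassoc_of% hf, reassoc_of% hs, hl, hr]
  rw [← key]
  rfl

/-- The `ℂ`-linear structure given by the scalar endomorphisms. -/
noncomputable instance linearStructure [Preadditive (CSl2Obj f)] : Linear ℂ (CSl2Obj f) where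
  homModule M N :=
    { smul c φ := φ ≫ scalarHom c N
      one_smul φ := hom_ext fun v => one_smul ℂ (lin φ v)
      mul_smul c d φ := hom_ext fun v => mul_smul c d (lin φ v)
      smul_zero c := zero_comp
      smul_add c φ ψ := Preadditive.add_comp _ _ _ _ _ _
      add_smul c d φ := hom_ext fun v => by
        rw [lin_add]
        exact add_smul c d (lin φ v)
      zero_smul φ := eq_zero_of_lin fun v => zero_smul ℂ (lin φ v) }
  smul_comp M N K c φ ψ := hom_ext fun v => map_smul (lin ψ) c (lin φ v)
  comp_smul M N K φ c ψ := hom_ext fun v => rfl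

/-! ### Monomorphisms, epimorphisms, exactness -/

theorem mono_of_injective {M N : CSl2Obj f} (φ : M ⟶ N) (h : Function.Injective (lin φ)) :
    Mono φ where
  right_cancellation g g' hg := hom_ext fun v => h (by simp only [← lin_comp, hg])

theorem epi_of_surjective {M N : CSl2Obj f} (φ : M ⟶ N) (h : Function.Surjective (lin φ)) :
    Epi φ where
  left_cancellation g g' hg := hom_ext fun v => by
    obtain ⟨v, rfl⟩ := h v
    simp only [← lin_comp, hg]

theorem surjective_of_epi [Abelian (CSl2Obj f)] {M N : CSl2Obj f} (φ : M ⟶ N) [Epi φ] :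
    Function.Surjective (lin φ) := by
  let I := subObj N (LinearMap.range (lin φ))
    (fun n v ⟨w, hw⟩ => ⟨proj M n w, by rw [lin_proj, hw]⟩)
    (fun v ⟨w, hw⟩ => ⟨M.x w, by rw [lin_x, hw]⟩) (fun v ⟨w, hw⟩ => ⟨M.y w, by rw [lin_y, hw]⟩)
  let ι : I ⟶ N := ⟨Submodule.subtype _, fun _ _ hv => hv, fun _ => rfl, fun _ => rfl⟩
  let π : M ⟶ I := ⟨(lin φ).rangeRestrict, fun _ _ hv => lin_mem φ hv,
    fun v => Subtype.ext (lin_x φ v), fun v => Subtype.ext (lin_y φ v)⟩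
  have hπ : π ≫ ι = φ := rfl
  have : Mono ι := mono_of_injective _ Subtype.val_injective
  have : Epi ι := epi_of_epi_fac hπ
  have : IsIso ι := isIso_of_mono_of_epi ι
  intro v
  obtain ⟨w, hw⟩ := (lin (inv ι) v).2
  refine ⟨w, hw.trans ?_⟩
  change lin (inv ι ≫ ι) v = v
  simp

theorem mem_grading_of_injective {M N : CSl2Obj f} (φ : M ⟶ N) (h : Function.Injective (lin φ))
    {n : ℤ} {v : M.carrier} (hv : lin φ v ∈ N.grading n) : v ∈ M.grading n := by
  have : proj M n v = v := h (by rw [lin_proj, proj_same hv])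
  exact this ▸ proj_mem M n v

theorem shortExact [Abelian (CSl2Obj f)] {A B C : CSl2Obj f} (φ : A ⟶ B) (ψ : B ⟶ C)
    (hφ : Function.Injective (lin φ)) (hψ : Function.Surjective (lin ψ))
    (hzero : ∀ v, lin ψ (lin φ v) = 0) (hex : ∀ v, lin ψ v = 0 → ∃ w, lin φ w = v) :
    (ShortComplex.mk φ ψ (eq_zero_of_lin hzero)).ShortExact := by
  have := mono_of_injective φ hφ
  have := epi_of_surjective ψ hψ
  refine ShortComplex.ShortExact.mk' ?_ ‹_› ‹_›
  refine ShortComplex.exact_of_f_is_kernel _ (KernelFork.IsLimit.ofι' _ _ fun {W} k hk => ?_)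
  have hr : ∀ v, lin k v ∈ LinearMap.range (lin φ) := fun v =>
    hex _ (by rw [← lin_comp]; exact (congrArg (lin · v) hk).trans (lin_zero v))
  let e := LinearEquiv.ofInjective (lin φ) hφ
  let l : W.carrier →ₗ[ℂ] A.carrier := e.symm.toLinearMap ∘ₗ (lin k).codRestrict _ hr
  have hl : ∀ v, lin φ (l v) = lin k v := fun v =>
    congrArg Subtype.val (e.apply_symm_apply ⟨lin k v, hr v⟩)
  exact ⟨⟨l, fun n v hv => mem_grading_of_injective φ hφ (by rw [hl]; exact lin_mem k hv),
    fun v => hφ (by rw [hl, lin_x, lin_x, hl]), fun v => hφ (by rw [hl, lin_y, lin_y, hl])⟩,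
    hom_ext hl⟩

/-! ### Objects given by a basis -/

/-- The object with a basis of weight vectors indexed by `ι`. -/
noncomputable abbrev basisObj {ι : Type} (w : ι → ℤ) (X Y : ι → ι →₀ ℂ)
    (hX : ∀ i, X i ∈ Finsupp.supported ℂ ℂ {j | w j = w i + 1})
    (hY : ∀ i, Y i ∈ Finsupp.supported ℂ ℂ {j | w j = w i - 1})
    (hXY : ∀ i, Finsupp.linearCombination ℂ X (Y i) - Finsupp.linearCombination ℂ Y (X i) =
      Finsupp.single i (f (w i))) : CSl2Obj f where
  carrier := ι →₀ ℂ
  grading n := Finsupp.supported ℂ ℂ {j | w j = n}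
  internal := by
    refine isInternal_of_projections _
      (fun n => (Finsupp.supported ℂ ℂ {j | w j = n}).subtype ∘ₗ Finsupp.restrictDom ℂ ℂ _)
      (fun n v hv => ?_) (fun m n hmn v hv => ?_) fun v => ?_
    · simpa [Finsupp.restrictDom_apply, Finsupp.filter_eq_self_iff, Finsupp.mem_supported'] using
        fun i hi => by_contra fun h => hi ((Finsupp.mem_supported' ℂ v).1 hv i h)
    · rw [LinearMap.comp_apply, Submodule.subtype_apply, Finsupp.restrictDom_apply,
        Finsupp.filter_eq_zero_iff]
      exact fun i hi => (Finsupp.mem_supported' ℂ v).1 hv i fun h => hmn (h.symm.trans hi)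
    · induction v using Finsupp.induction_linear with
      | zero => exact zero_mem _
      | add v v' hv hv' => exact add_mem hv hv'
      | single i c =>
        exact Submodule.mem_iSup_of_mem (w i) (Finsupp.single_mem_supported ℂ c rfl)
  x := Finsupp.linearCombination ℂ X
  y := Finsupp.linearCombination ℂ Y
  x_mem n v hv := by
    rw [Finsupp.linearCombination_apply]
    exact Submodule.sum_mem _ fun i hi => Submodule.smul_mem _ _ <| by
      have : w i = n := hv hi
      exact this ▸ hX i
  y_mem n v hv := by
    rw [Finsupp.linearCombination_apply]
    exact Submodule.sum_mem _ fun i hi => Submodule.smul_mem _ _ <| by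
      have : w i = n := hv hi
      exact this ▸ hY i
  comm n v hv := by
    rw [Finsupp.linearCombination_apply ℂ v, Finsupp.linearCombination_apply ℂ v, Finsupp.sum,
      Finsupp.sum, map_sum, map_sum, ← Finset.sum_sub_distrib]
    conv_rhs => rw [← Finsupp.sum_single v, Finsupp.sum, Finset.smul_sum]
    refine Finset.sum_congr rfl fun i hi => ?_
    have : w i = n := hv hi
    rw [map_smul, map_smul, ← smul_sub, hXY, this, Finsupp.smul_single, Finsupp.smul_single,
      smul_eq_mul, smul_eq_mul, mul_comm]

/-- The morphism out of `basisObj` with prescribed values on the basis. -/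
noncomputable def basisHom {ι : Type} {w : ι → ℤ} {X Y : ι → ι →₀ ℂ}
    {hX : ∀ i, X i ∈ Finsupp.supported ℂ ℂ {j | w j = w i + 1}}
    {hY : ∀ i, Y i ∈ Finsupp.supported ℂ ℂ {j | w j = w i - 1}}
    {hXY : ∀ i, Finsupp.linearCombination ℂ X (Y i) - Finsupp.linearCombination ℂ Y (X i) =
      Finsupp.single i (f (w i))} {V : CSl2Obj f} (u : ι → V.carrier)
    (hu : ∀ i, u i ∈ V.grading (w i))
    (hx : ∀ i, Finsupp.linearCombination ℂ u (X i) = V.x (u i))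
    (hy : ∀ i, Finsupp.linearCombination ℂ u (Y i) = V.y (u i)) :
    basisObj w X Y hX hY hXY ⟶ V :=
  ⟨Finsupp.linearCombination ℂ u, fun n v hv => by
    rw [Finsupp.linearCombination_apply]
    exact Submodule.sum_mem _ fun i hi => Submodule.smul_mem _ _ <| by
      have : w i = n := hv hi
      exact this ▸ hu i,
    fun v => by
      induction v using Finsupp.induction_linear with
      | zero => simp
      | add v v' hv hv' => rw [map_add, map_add, map_add, map_add, hv, hv']
      | single i c => simp [hx],
    fun v => by
      induction v using Finsupp.induction_linear with
      | zero => simp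
      | add v v' hv hv' => rw [map_add, map_add, map_add, map_add, hv, hv']
      | single i c => simp [hy]⟩

/-- The scalar `d` in `x yⁱ v = yⁱ x v + d • yⁱ⁻¹ v`, for `v` of weight `m`. -/
noncomputable def commCoeff (f : ℤ → ℂ) (m : ℤ) (i : ℕ) : ℂ := ∑ k ∈ Finset.range i, f (m - k)

@[simp]
theorem commCoeff_zero (m : ℤ) : commCoeff f m 0 = 0 := rfl

theorem commCoeff_succ (m : ℤ) (i : ℕ) :
    commCoeff f m (i + 1) = commCoeff f m i + f (m - i) := Finset.sum_range_succ _ _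

theorem x_y_pow (M : CSl2Obj f) {m : ℤ} {v : M.carrier} (hv : v ∈ M.grading m) (i : ℕ) :
    M.x ((M.y ^ i) v) = (M.y ^ i) (M.x v) + commCoeff f m i • (M.y ^ (i - 1)) v := by
  induction i with
  | zero => simp
  | succ i ih =>
    have h := M.comm _ _ (y_pow_mem M hv i)
    rw [sub_eq_iff_eq_add] at h
    rw [pow_succ', Module.End.mul_apply, h, ih, commCoeff_succ, map_add, map_smul, add_smul,
      Module.End.mul_apply, Nat.add_sub_cancel]
    cases i with
    | zero => simp [add_comm]
    | succ i =>
      rw [Nat.add_sub_cancel, ← Module.End.mul_apply M.y (M.y ^ i), ← pow_succ']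
      abel

/-- The free object on a generator of weight `n`; the basis vector `(i, j)` is `yⁱ xʲ`
applied to the generator. -/
noncomputable abbrev freeObj (f : ℤ → ℂ) (n : ℤ) : CSl2Obj f :=
  basisObj (ι := ℕ × ℕ) (fun p => n + p.2 - p.1)
    (fun p => Finsupp.single (p.1, p.2 + 1) 1 +
      Finsupp.single (p.1 - 1, p.2) (commCoeff f (n + p.2) p.1))
    (fun p => Finsupp.single (p.1 + 1, p.2) 1)
    (fun ⟨i, j⟩ => by
      refine add_mem (Finsupp.single_mem_supported ℂ _ ?_) ?_
      · simp only [Set.mem_ofPred_eq]; push_cast; ring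
      · cases i with
        | zero => simp
        | succ i =>
          refine Finsupp.single_mem_supported ℂ _ ?_
          simp only [Set.mem_ofPred_eq, Nat.add_sub_cancel]; push_cast; ring)
    (fun ⟨i, j⟩ => Finsupp.single_mem_supported ℂ _ <| by
      simp only [Set.mem_ofPred_eq]; push_cast; ring)
    (fun ⟨i, j⟩ => by
      cases i with
      | zero => simp [commCoeff_succ]
      | succ i => simp [commCoeff_succ (n + j) (i + 1), ← sub_sub])

/-- The Verma object with highest weight `n`; the basis vector `i` is `yⁱ` applied to the
highest weight vector. -/
noncomputable abbrev vermaObj (f : ℤ → ℂ) (n : ℤ) : CSl2Obj f :=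
  basisObj (ι := ℕ) (fun i => n - i)
    (fun i => Finsupp.single (i - 1) (commCoeff f n i))
    (fun i => Finsupp.single (i + 1) 1)
    (fun i => by
      cases i with
      | zero => simp
      | succ i =>
        refine Finsupp.single_mem_supported ℂ _ ?_
        simp only [Set.mem_ofPred_eq, Nat.add_sub_cancel]; push_cast; ring)
    (fun i => Finsupp.single_mem_supported ℂ _ <| by
      simp only [Set.mem_ofPred_eq]; push_cast; ring)
    (fun i => by
      cases i with
      | zero => simp [commCoeff_succ]
      | succ i => simp [commCoeff_succ n (i + 1)])

theorem freeObj_y_pow (n : ℤ) (i i' j : ℕ) :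
    ((freeObj f n).y ^ i) (Finsupp.single (i', j) 1) = Finsupp.single (i' + i, j) 1 := by
  induction i with
  | zero => simp
  | succ i ih => rw [pow_succ', Module.End.mul_apply, ih]; simp [add_assoc]

theorem freeObj_x_pow (n : ℤ) (j j' : ℕ) :
    ((freeObj f n).x ^ j) (Finsupp.single (0, j') 1) = Finsupp.single (0, j' + j) 1 := by
  induction j with
  | zero => simp
  | succ j ih => rw [pow_succ', Module.End.mul_apply, ih]; simp [add_assoc]

theorem vermaObj_y_pow (n : ℤ) (i j : ℕ) :
    ((vermaObj f n).y ^ i) (Finsupp.single j 1) = Finsupp.single (j + i) 1 := by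
  induction i with
  | zero => simp
  | succ i ih => rw [pow_succ', Module.End.mul_apply, ih]; simp [add_assoc]

/-- The morphism from the free object with prescribed value on the generator. -/
noncomputable def freeHom {V : CSl2Obj f} {n : ℤ} (v : V.carrier) (hv : v ∈ V.grading n) :
    freeObj f n ⟶ V :=
  basisHom (fun p => (V.y ^ p.1) ((V.x ^ p.2) v)) (fun p => y_pow_mem V (x_pow_mem V hv p.2) p.1)
    (fun p => by
      rw [x_y_pow V (x_pow_mem V hv p.2), ← Module.End.mul_apply V.x, ← pow_succ']
      simp)
    (fun p => by rw [← Module.End.mul_apply V.y, ← pow_succ']; simp)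

@[simp]
theorem lin_freeHom_single {V : CSl2Obj f} {n : ℤ} (v : V.carrier) (hv : v ∈ V.grading n)
    (p : ℕ × ℕ) (c : ℂ) :
    lin (freeHom v hv) (Finsupp.single p c) = c • (V.y ^ p.1) ((V.x ^ p.2) v) :=
  Finsupp.linearCombination_single ℂ c p

/-- The morphism from a Verma object with prescribed value on the highest weight vector. -/
noncomputable def vermaHom {V : CSl2Obj f} {n : ℤ} (v : V.carrier) (hv : v ∈ V.grading n)
    (hxv : V.x v = 0) : vermaObj f n ⟶ V :=
  basisHom (fun i => (V.y ^ i) v) (fun i => y_pow_mem V hv i)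
    (fun i => by rw [x_y_pow V hv, hxv]; simp)
    (fun i => by rw [← Module.End.mul_apply V.y, ← pow_succ']; simp)

@[simp]
theorem lin_vermaHom_single {V : CSl2Obj f} {n : ℤ} (v : V.carrier) (hv : v ∈ V.grading n)
    (hxv : V.x v = 0) (i : ℕ) (c : ℂ) :
    lin (vermaHom v hv hxv) (Finsupp.single i c) = c • (V.y ^ i) v :=
  Finsupp.linearCombination_single ℂ c i

/-- The generator of the free object. -/
noncomputable abbrev freeGen (f : ℤ → ℂ) (n : ℤ) : (freeObj f n).carrier :=
  Finsupp.single (0, 0) 1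

theorem freeGen_mem (n : ℤ) : freeGen f n ∈ (freeObj f n).grading n :=
  Finsupp.single_mem_supported ℂ _ (by simp)

theorem freeObj_hom_ext {V : CSl2Obj f} {n : ℤ} {φ ψ : freeObj f n ⟶ V}
    (h : lin φ (freeGen f n) = lin ψ (freeGen f n)) : φ = ψ := by
  suffices lin φ = lin ψ from hom_ext (LinearMap.congr_fun this)
  refine Finsupp.lhom_ext' fun ⟨i, j⟩ => LinearMap.ext_ring ?_
  have hij : Finsupp.single (i, j) 1 =
      ((freeObj f n).y ^ i) (((freeObj f n).x ^ j) (freeGen f n)) := by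
    rw [freeObj_x_pow, freeObj_y_pow, zero_add, zero_add]
  change lin φ (Finsupp.single (i, j) 1) = lin ψ (Finsupp.single (i, j) 1)
  rw [hij, lin_y_pow, lin_y_pow, lin_x_pow, lin_x_pow, h]

theorem projective_freeObj [Abelian (CSl2Obj f)] (n : ℤ) : Projective (freeObj f n) where
  factors φ e _ := by
    obtain ⟨w, hw⟩ := surjective_of_epi e (lin φ (freeGen f n))
    refine ⟨freeHom (proj _ n w) (proj_mem _ n w), freeObj_hom_ext ?_⟩
    rw [lin_comp, lin_freeHom_single, one_smul, pow_zero, pow_zero, Module.End.one_apply,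
      Module.End.one_apply, lin_proj, hw, proj_same (lin_mem φ (freeGen_mem n))]

/-! ### Short exact sequences -/

/-- The inclusion of the free object of weight `n + 1` in that of weight `n`. -/
noncomputable def freeIncl (f : ℤ → ℂ) (n : ℤ) : freeObj f (n + 1) ⟶ freeObj f n :=
  freeHom (Finsupp.single (0, 1) 1) (Finsupp.single_mem_supported ℂ _ (by simp))

/-- The projection of the free object onto the Verma object. -/
noncomputable def freeToVerma (f : ℤ → ℂ) (n : ℤ) : freeObj f n ⟶ vermaObj f n :=
  freeHom (Finsupp.single 0 1) (Finsupp.single_mem_supported ℂ _ (by simp))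

theorem lin_freeIncl_single (n : ℤ) (i j : ℕ) (c : ℂ) :
    lin (freeIncl f n) (Finsupp.single (i, j) c) = Finsupp.single (i, j + 1) c := by
  rw [freeIncl, lin_freeHom_single, freeObj_x_pow, freeObj_y_pow]
  simp [add_comm]

theorem lin_freeToVerma_single_zero (n : ℤ) (i : ℕ) (c : ℂ) :
    lin (freeToVerma f n) (Finsupp.single (i, 0) c) = Finsupp.single i c := by
  rw [freeToVerma, lin_freeHom_single, pow_zero, Module.End.one_apply, vermaObj_y_pow]
  simp

theorem lin_freeToVerma_single_succ (n : ℤ) (i j : ℕ) (c : ℂ) :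
    lin (freeToVerma f n) (Finsupp.single (i, j + 1) c) = 0 := by
  rw [freeToVerma, lin_freeHom_single, pow_succ, Module.End.mul_apply]
  simp

theorem freeIncl_injective (n : ℤ) : Function.Injective (lin (freeIncl f n)) := by
  have h : lin (freeIncl f n) = Finsupp.lmapDomain ℂ ℂ fun p : ℕ × ℕ => (p.1, p.2 + 1) :=
    Finsupp.lhom_ext fun p c => by
      rw [lin_freeIncl_single, Finsupp.lmapDomain_apply, Finsupp.mapDomain_single]
  rw [h]
  exact Finsupp.mapDomain_injective fun p q hpq => by simpa [Prod.ext_iff] using hpq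

theorem freeToVerma_surjective (n : ℤ) : Function.Surjective (lin (freeToVerma f n)) := by
  intro v
  induction v using Finsupp.induction_linear with
  | zero => exact ⟨0, map_zero _⟩
  | add v v' hv hv' =>
    obtain ⟨w, rfl⟩ := hv
    obtain ⟨w', rfl⟩ := hv'
    exact ⟨w + w', map_add _ _ _⟩
  | single i c => exact ⟨_, lin_freeToVerma_single_zero n i c⟩

theorem lin_freeToVerma_freeIncl (n : ℤ) (v : (freeObj f (n + 1)).carrier) :
    lin (freeToVerma f n) (lin (freeIncl f n) v) = 0 := by
  induction v using Finsupp.induction_linear with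
  | zero => rw [map_zero, map_zero]
  | add v v' hv hv' => rw [map_add, map_add, hv, hv', add_zero]
  | single p c => rw [lin_freeIncl_single, lin_freeToVerma_single_succ]

theorem exists_lin_freeIncl_eq (n : ℤ) (v : (freeObj f n).carrier)
    (hv : lin (freeToVerma f n) v = 0) : ∃ w, lin (freeIncl f n) w = v := by
  let s : (vermaObj f n).carrier →ₗ[ℂ] (freeObj f n).carrier :=
    Finsupp.lmapDomain ℂ ℂ fun i => (i, 0)
  have hs : ∀ v, ∃ w, lin (freeIncl f n) w = v - s (lin (freeToVerma f n) v) := by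
    intro v
    induction v using Finsupp.induction_linear with
    | zero => exact ⟨0, by simp⟩
    | add v v' hv hv' =>
      obtain ⟨w, hw⟩ := hv
      obtain ⟨w', hw'⟩ := hv'
      exact ⟨w + w', by rw [map_add, hw, hw', map_add, map_add]; abel⟩
    | single p c =>
      obtain ⟨i, j⟩ := p
      cases j with
      | zero =>
        refine ⟨0, ?_⟩
        rw [lin_freeToVerma_single_zero, map_zero, Finsupp.lmapDomain_apply,
          Finsupp.mapDomain_single, sub_self]
      | succ j =>
        refine ⟨Finsupp.single (i, j) c, ?_⟩
        rw [lin_freeToVerma_single_succ, map_zero, sub_zero, lin_freeIncl_single]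
  simpa [hv] using hs v

theorem shortExact_free [Abelian (CSl2Obj f)] (n : ℤ) :
    (ShortComplex.mk (freeIncl f n) (freeToVerma f n)
      (eq_zero_of_lin (lin_freeToVerma_freeIncl n))).ShortExact :=
  shortExact _ _ (freeIncl_injective n) (freeToVerma_surjective n) (lin_freeToVerma_freeIncl n)
    (exists_lin_freeIncl_eq n)

/-- A highest weight vector of weight `b` killed by exactly the `(N + 1)`-st power of `y`,
in an object without vectors of weight `b + 1`. -/
structure IsHighestWeight (V : CSl2Obj f) (b : ℤ) (N : ℕ) (v : V.carrier) : Prop where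
  mem : v ∈ V.grading b
  x_eq : V.x v = 0
  grading_succ : V.grading (b + 1) = ⊥
  pow_ne : ∀ k ≤ N, (V.y ^ k) v ≠ 0
  pow_eq : (V.y ^ (N + 1)) v = 0

theorem exists_isHighestWeight (V : CSl2Obj f) [Nontrivial V.carrier]
    [FiniteDimensional ℂ V.carrier] : ∃ b N v, IsHighestWeight V b N v := by
  have hfin : {n | V.grading n ≠ ⊥}.Finite :=
    WellFoundedGT.finite_ne_bot_of_iSupIndep V.internal.submodule_iSupIndep
  have hne : {n | V.grading n ≠ ⊥}.Nonempty := by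
    by_contra h
    rw [Set.not_nonempty_iff_eq_empty, Set.eq_empty_iff_forall_notMem] at h
    have hbot : ∀ n, V.grading n = ⊥ := fun n => not_not.1 (h n)
    have := iSup_grading V
    simp [hbot] at this
  obtain ⟨b, hb, hmax⟩ := hfin.exists_maximal hne
  have hsucc : V.grading (b + 1) = ⊥ := by
    by_contra h
    have := hmax h (by lia)
    lia
  obtain ⟨v, hv, hv0⟩ := (Submodule.ne_bot_iff _).1 hb
  have hnil : ∃ k, (V.y ^ k) v = 0 := by
    by_contra! h
    refine Set.infinite_of_injective_forall_mem (f := fun k : ℕ => b - k)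
      (fun i j hij => by simpa using hij) (fun k => ?_) hfin
    exact (Submodule.ne_bot_iff _).2 ⟨_, y_pow_mem V hv k, h k⟩
  classical
  obtain ⟨N, hN⟩ : ∃ N, Nat.find hnil = N + 1 :=
    Nat.exists_eq_succ_of_ne_zero fun h => hv0 (by simpa [h] using Nat.find_spec hnil)
  exact ⟨b, N, v, hv, (Submodule.mem_bot ℂ).1 (hsucc ▸ V.x_mem _ _ hv), hsucc,
    fun k hk => Nat.find_min hnil (by lia), hN ▸ Nat.find_spec hnil⟩

namespace IsHighestWeight

variable {V : CSl2Obj f} {b : ℤ} {N : ℕ} {v : V.carrier} (hv : IsHighestWeight V b N v)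

theorem commCoeff_eq_zero (hv : IsHighestWeight V b N v) : commCoeff f b (N + 1) = 0 := by
  have h := x_y_pow V hv.mem (N + 1)
  rw [hv.pow_eq, hv.x_eq, map_zero, map_zero, zero_add, Nat.add_sub_cancel] at h
  exact (smul_eq_zero.1 h.symm).resolve_right (hv.pow_ne N le_rfl)

/-- The projection of the Verma object onto a highest weight object. -/
noncomputable def vermaProj : vermaObj f b ⟶ V := vermaHom v hv.mem hv.x_eq

/-- The kernel of `vermaProj`, when it is surjective. -/
noncomputable def vermaIncl : vermaObj f (b - (N + 1 : ℕ)) ⟶ vermaObj f b :=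
  vermaHom (Finsupp.single (N + 1) 1) (Finsupp.single_mem_supported ℂ _ rfl)
    (by simp [hv.commCoeff_eq_zero])

theorem lin_vermaProj_single (i : ℕ) (c : ℂ) :
    lin hv.vermaProj (Finsupp.single i c) = c • (V.y ^ i) v :=
  lin_vermaHom_single _ _ _ _ _

theorem lin_vermaIncl_single (i : ℕ) (c : ℂ) :
    lin hv.vermaIncl (Finsupp.single i c) = Finsupp.single (N + 1 + i) c := by
  rw [vermaIncl, lin_vermaHom_single, vermaObj_y_pow]
  simp

theorem lin_vermaIncl :
    lin hv.vermaIncl = Finsupp.lmapDomain ℂ ℂ (N + 1 + ·) :=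
  Finsupp.lhom_ext fun i c => by
    rw [lin_vermaIncl_single, Finsupp.lmapDomain_apply, Finsupp.mapDomain_single]

theorem vermaIncl_injective : Function.Injective (lin hv.vermaIncl) := by
  rw [lin_vermaIncl]
  exact Finsupp.mapDomain_injective (add_right_injective _)

theorem lin_vermaProj_vermaIncl (w : (vermaObj f (b - (N + 1 : ℕ))).carrier) :
    lin hv.vermaProj (lin hv.vermaIncl w) = 0 := by
  induction w using Finsupp.induction_linear with
  | zero => rw [map_zero, map_zero]
  | add w w' h h' => rw [map_add, map_add, h, h', add_zero]
  | single i c =>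
    rw [lin_vermaIncl_single, lin_vermaProj_single, add_comm, pow_add, Module.End.mul_apply,
      hv.pow_eq, map_zero, smul_zero]

theorem proj_lin_vermaProj (k : ℕ) (w : (vermaObj f b).carrier) :
    proj V (b - k) (lin hv.vermaProj w) = w k • (V.y ^ k) v := by
  induction w using Finsupp.induction_linear with
  | zero => simp
  | add w w' h h' => rw [map_add, map_add, h, h', Finsupp.add_apply, add_smul]
  | single i c =>
    rw [lin_vermaProj_single, map_smul]
    by_cases h : i = k
    · subst h
      rw [proj_same (y_pow_mem V hv.mem i), Finsupp.single_eq_same]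
    · rw [proj_ne (by lia) (y_pow_mem V hv.mem i), Finsupp.single_eq_of_ne' h]
      simp

theorem exists_lin_vermaIncl_eq (w : (vermaObj f b).carrier) (hw : lin hv.vermaProj w = 0) :
    ∃ u, lin hv.vermaIncl u = w := by
  have hinj : Function.Injective (N + 1 + · : ℕ → ℕ) := add_right_injective _
  refine ⟨Finsupp.comapDomain (N + 1 + ·) w hinj.injOn, ?_⟩
  rw [lin_vermaIncl]
  refine Finsupp.mapDomain_comapDomain _ hinj w fun k hk => ?_
  by_contra h
  have hk' : k ≤ N := by
    by_contra hkN
    exact h ⟨k - (N + 1), by dsimp only; lia⟩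
  have := hv.proj_lin_vermaProj k w
  rw [hw, map_zero, eq_comm, smul_eq_zero] at this
  exact (Finsupp.mem_support_iff.1 hk) (this.resolve_right (hv.pow_ne k hk'))

theorem lin_vermaProj_ne_zero : lin hv.vermaProj (Finsupp.single 0 1) ≠ 0 := by
  rw [lin_vermaProj_single, one_smul]
  exact hv.pow_ne 0 N.zero_le

variable [Abelian (CSl2Obj f)] [Simple V]

theorem epi_vermaProj : Epi hv.vermaProj :=
  epi_of_nonzero_to_simple fun h => hv.lin_vermaProj_ne_zero (by rw [h, lin_zero])

theorem shortExact_verma :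
    (ShortComplex.mk hv.vermaIncl hv.vermaProj
      (eq_zero_of_lin hv.lin_vermaProj_vermaIncl)).ShortExact :=
  have := hv.epi_vermaProj
  shortExact _ _ hv.vermaIncl_injective (surjective_of_epi _) hv.lin_vermaProj_vermaIncl
    hv.exists_lin_vermaIncl_eq

theorem exists_eq_smul (hv : IsHighestWeight V b N v) {k : ℕ} {w : V.carrier} (hw : w ∈ V.grading (b - k)) :
    ∃ c : ℂ, w = c • (V.y ^ k) v := by
  have := hv.epi_vermaProj
  obtain ⟨u, rfl⟩ := surjective_of_epi hv.vermaProj w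
  exact ⟨u k, by rw [← hv.proj_lin_vermaProj, proj_same hw]⟩

theorem grading_low (hv : IsHighestWeight V b N v) : V.grading (b - (N + 1 : ℕ)) = ⊥ := by
  refine (Submodule.eq_bot_iff _).2 fun w hw => ?_
  obtain ⟨c, rfl⟩ := hv.exists_eq_smul hw
  rw [hv.pow_eq, smul_zero]

theorem exists_end_eq_smul (hv : IsHighestWeight V b N v) (φ : V ⟶ V) : ∃ c : ℂ, φ = c • 𝟙 V := by
  have := hv.epi_vermaProj
  obtain ⟨c, hc⟩ := hv.exists_eq_smul (k := 0) (w := lin φ v) (by simpa using lin_mem φ hv.mem)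
  refine ⟨c, (cancel_epi hv.vermaProj).1 (hom_ext fun w => ?_)⟩
  rw [lin_comp]
  change lin φ (lin hv.vermaProj w) = c • lin hv.vermaProj w
  induction w using Finsupp.induction_linear with
  | zero => simp
  | add w w' h h' => rw [map_add, map_add, h, h', smul_add]
  | single i d =>
    rw [lin_vermaProj_single, map_smul, lin_y_pow, hc, pow_zero, Module.End.one_apply, map_smul,
      smul_comm]

end IsHighestWeight

/-! ### Ext groups -/

theorem freeObj_hom_eq_zero [Abelian (CSl2Obj f)] {V : CSl2Obj f} {n : ℤ} (h : V.grading n = ⊥)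
    (φ : freeObj f n ⟶ V) : φ = 0 :=
  freeObj_hom_ext (by
    rw [lin_zero]
    exact (Submodule.mem_bot ℂ).1 (h ▸ lin_mem φ (freeGen_mem n)))

section Ext

variable [Abelian (CSl2Obj f)] [HasExt.{0} (CSl2Obj f)]

theorem ext_freeObj_zero_eq_zero {V : CSl2Obj f} {n : ℤ} (h : V.grading n = ⊥)
    (α : Ext (freeObj f n) V 0) : α = 0 := by
  obtain ⟨φ, rfl⟩ := (Ext.mk₀_bijective _ _).2 α
  rw [freeObj_hom_eq_zero h φ, Ext.mk₀_zero]

theorem ext_freeObj_succ_eq_zero {V : CSl2Obj f} {n : ℤ} {k : ℕ}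
    (α : Ext (freeObj f n) V (k + 1)) : α = 0 :=
  have := projective_freeObj (f := f) n
  Ext.eq_zero_of_projective α

theorem exists_eq_extClass_free_comp {V : CSl2Obj f} {n : ℤ} {k : ℕ}
    (α : Ext (vermaObj f n) V (k + 1)) :
    ∃ β : Ext (freeObj f (n + 1)) V k,
      (shortExact_free n).extClass.comp β (Nat.add_comm 1 k) = α :=
  Ext.contravariant_sequence_exact₃ (shortExact_free n) V α (ext_freeObj_succ_eq_zero _) _

theorem ext_vermaObj_eq_zero_of_grading_succ {V : CSl2Obj f} {n : ℤ}
    (h : V.grading (n + 1) = ⊥) {k : ℕ} (α : Ext (vermaObj f n) V (k + 1)) : α = 0 := by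
  obtain ⟨β, rfl⟩ := exists_eq_extClass_free_comp α
  cases k with
  | zero => rw [ext_freeObj_zero_eq_zero h β, Ext.comp_zero]
  | succ k => rw [ext_freeObj_succ_eq_zero β, Ext.comp_zero]

theorem ext_vermaObj_add_two_eq_zero {V : CSl2Obj f} {n : ℤ} {k : ℕ}
    (α : Ext (vermaObj f n) V (k + 2)) : α = 0 := by
  obtain ⟨β, rfl⟩ := exists_eq_extClass_free_comp α
  rw [ext_freeObj_succ_eq_zero β, Ext.comp_zero]

theorem ext_vermaObj_zero_eq_zero {V : CSl2Obj f} {n : ℤ} (h : V.grading n = ⊥)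
    (α : Ext (vermaObj f n) V 0) : α = 0 := by
  obtain ⟨φ, rfl⟩ := (Ext.mk₀_bijective _ _).2 α
  have := epi_of_surjective _ (freeToVerma_surjective (f := f) n)
  have hφ : φ = 0 :=
    (cancel_epi (freeToVerma f n)).1 ((freeObj_hom_eq_zero h _).trans comp_zero.symm)
  rw [hφ, Ext.mk₀_zero]

theorem eq_zero_of_extClass_free_comp_eq_zero {V : CSl2Obj f} {n : ℤ} (h : V.grading n = ⊥)
    {β : Ext (freeObj f (n + 1)) V 0}
    (hβ : (shortExact_free n).extClass.comp β (add_zero 1) = 0) : β = 0 := by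
  obtain ⟨γ, rfl⟩ := Ext.contravariant_sequence_exact₁ (shortExact_free n) V β (add_zero 1) hβ
  rw [ext_freeObj_zero_eq_zero h γ, Ext.comp_zero]

namespace IsHighestWeight

variable {V : CSl2Obj f} {b : ℤ} {N : ℕ} {v : V.carrier} (hv : IsHighestWeight V b N v)
  [Simple V]

theorem exists_eq_extClass_verma_comp {k : ℕ} (α : Ext V V (k + 1)) :
    ∃ β : Ext (vermaObj f (b - (N + 1 : ℕ))) V k,
      hv.shortExact_verma.extClass.comp β (Nat.add_comm 1 k) = α :=
  Ext.contravariant_sequence_exact₃ hv.shortExact_verma V α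
    (ext_vermaObj_eq_zero_of_grading_succ hv.grading_succ _) _

theorem ext_one_eq_zero (hv : IsHighestWeight V b N v) (α : Ext V V 1) : α = 0 := by
  obtain ⟨β, rfl⟩ := hv.exists_eq_extClass_verma_comp (k := 0) α
  rw [ext_vermaObj_zero_eq_zero hv.grading_low β, Ext.comp_zero]

theorem ext_add_three_eq_zero (hv : IsHighestWeight V b N v) {k : ℕ} (α : Ext V V (k + 3)) :
    α = 0 := by
  obtain ⟨β, rfl⟩ := hv.exists_eq_extClass_verma_comp (k := k + 2) α
  rw [ext_vermaObj_add_two_eq_zero β, Ext.comp_zero]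

theorem ext_zero_eq_smul (hv : IsHighestWeight V b N v) (α : Ext V V 0) :
    ∃ c : ℂ, α = c • Ext.mk₀ (𝟙 V) := by
  obtain ⟨φ, rfl⟩ := (Ext.mk₀_bijective _ _).2 α
  obtain ⟨c, rfl⟩ := hv.exists_end_eq_smul φ
  exact ⟨c, Ext.mk₀_smul c _⟩

theorem exists_ext_two_generator (hv : IsHighestWeight V b N v) :
    ∃ α₀ : Ext V V 2, α₀ ≠ 0 ∧ ∀ α : Ext V V 2, ∃ c : ℂ, α = c • α₀ := by
  have hw : b - N = b - (N + 1 : ℕ) + 1 := by push_cast; ring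
  let φ₀ : freeObj f (b - (N + 1 : ℕ) + 1) ⟶ V :=
    freeHom ((V.y ^ N) v) (hw ▸ y_pow_mem V hv.mem N)
  have hφ₀ : lin φ₀ (freeGen f _) = (V.y ^ N) v := by
    rw [lin_freeHom_single]
    simp
  refine ⟨hv.shortExact_verma.extClass.comp
    ((shortExact_free _).extClass.comp (Ext.mk₀ φ₀) (add_zero 1)) (add_comm 1 1), ?_, ?_⟩
  · intro h
    obtain ⟨γ, hγ⟩ := Ext.contravariant_sequence_exact₁ hv.shortExact_verma V _ _ h
    rw [ext_vermaObj_eq_zero_of_grading_succ hv.grading_succ (k := 0) γ, Ext.comp_zero] at hγ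
    have := (Ext.mk₀_eq_zero_iff _).1 (eq_zero_of_extClass_free_comp_eq_zero hv.grading_low hγ.symm)
    exact hv.pow_ne N le_rfl (by rw [← hφ₀, this, lin_zero])
  · intro α
    obtain ⟨β, rfl⟩ := hv.exists_eq_extClass_verma_comp (k := 1) α
    obtain ⟨γ, rfl⟩ := exists_eq_extClass_free_comp (k := 0) β
    obtain ⟨φ, rfl⟩ := (Ext.mk₀_bijective _ _).2 γ
    obtain ⟨c, hc⟩ := hv.exists_eq_smul (k := N) (w := lin φ (freeGen f _))
      (by rw [hw]; exact lin_mem φ (freeGen_mem _))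
    have : φ = c • φ₀ := freeObj_hom_ext (by
      rw [hc, ← hφ₀]
      rfl)
    exact ⟨c, by rw [this, Ext.mk₀_smul, Ext.comp_smul, Ext.comp_smul]⟩

end IsHighestWeight

end Ext

theorem exists_linearEquiv_span_singleton {M W : Type} [AddCommGroup M] [Module ℂ M]
    [AddCommGroup W] [Module ℂ W] {a : M} (ha : a ≠ 0) (hspan : ∀ m : M, ∃ c : ℂ, m = c • a)
    {S : Submodule ℂ W} {w : W} (hw : w ≠ 0) (hS : S = Submodule.span ℂ {w}) :
    ∃ e : M ≃ₗ[ℂ] S, (e a : W) = w := by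
  subst hS
  let e₁ : ℂ ≃ₗ[ℂ] M := LinearEquiv.ofBijective (LinearMap.toSpanSingleton ℂ M a)
    ⟨smul_left_injective ℂ ha, fun m => (hspan m).imp fun c hc => hc.symm⟩
  have h₁ : e₁ 1 = a := one_smul ℂ a
  refine ⟨e₁.symm ≪≫ₗ LinearEquiv.toSpanNonzeroSingleton ℂ W w hw, ?_⟩
  rw [← h₁]
  simp

theorem exists_linearEquiv_of_eq_bot {M W : Type} [AddCommGroup M] [Module ℂ M]
    [AddCommGroup W] [Module ℂ W] (hM : ∀ m : M, m = 0) {S : Submodule ℂ W} (hS : S = ⊥) :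
    Nonempty (M ≃ₗ[ℂ] S) :=
  have : Subsingleton M := ⟨fun m m' => (hM m).trans (hM m').symm⟩
  have : Subsingleton S := (Submodule.subsingleton_iff_eq_bot).2 hS
  ⟨LinearEquiv.ofSubsingleton M S⟩

theorem nontrivial_carrier [Abelian (CSl2Obj f)] (V : CSl2Obj f) [Simple V] :
    Nontrivial V.carrier := by
  by_contra h
  rw [not_nontrivial_iff_subsingleton] at h
  exact id_nonzero V (eq_zero_of_lin fun v => Subsingleton.elim _ _)

end CSl2

open CategoryTheory.Abelian in
/-- **Fuser's theorem (Conjecture (5)(a) for `sl₂`), for `C(sl2,h,f)`.**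
For any simple object `V` of `C(sl2, h, f)` with finite-dimensional underlying vector
space, the Yoneda Ext-algebra `Ext^•(V,V)` is isomorphic as a graded ℂ-algebra to
`ℂ[t]/(t²) ≅ H^•(ℙ¹(ℂ), ℂ)`, with `t` of degree 2: there is a family of additive
isomorphisms in each degree which is multiplicative for the Yoneda composition product,
unital, and ℂ-linear (scalar multiplication on `Ext` being composition with `c • id`). -/
theorem ext_algebra_of_simple_in_CSl2_iso_cohomology_P1
    (h : ℂ) (f : ℤ → ℂ) [Abelian (CSl2Obj f)] [CategoryTheory.HasExt.{0} (CSl2Obj f)]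
    (V : CSl2Obj f) (hVsimple : Simple V) (hVfd : FiniteDimensional ℂ V.carrier) :
    ∃ e : ∀ n : ℕ, Ext V V n ≃+ P1CohomologyPiece n,
      ((e 0 (Ext.mk₀ (𝟙 V)) : DualNumber ℂ) = 1) ∧
      (∀ (p q : ℕ) (α : Ext V V p) (β : Ext V V q),
        (e (p + q) (α.comp β rfl) : DualNumber ℂ)
          = (e p α : DualNumber ℂ) * (e q β : DualNumber ℂ)) ∧
      (∀ (n : ℕ) (c : ℂ) (α : Ext V V n),
        (e n ((Ext.mk₀ (CSl2.scalarHom c V)).comp α (zero_add n)) : DualNumber ℂ)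
          = c • (e n α : DualNumber ℂ)) := by
  have := CSl2.nontrivial_carrier V
  obtain ⟨b, N, v, hv⟩ := CSl2.exists_isHighestWeight V
  obtain ⟨α₀, hα₀, hspan⟩ := hv.exists_ext_two_generator
  have hε : (DualNumber.eps : DualNumber ℂ) ≠ 0 := fun h => by
    simpa using congrArg TrivSqZeroExt.snd h
  obtain ⟨e₀, he₀⟩ := CSl2.exists_linearEquiv_span_singleton
    (mt (Ext.mk₀_eq_zero_iff _).1 (id_nonzero V)) hv.ext_zero_eq_smul
    (one_ne_zero (α := DualNumber ℂ)) (S := P1CohomologyPiece 0) rfl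
  obtain ⟨e₁⟩ := CSl2.exists_linearEquiv_of_eq_bot hv.ext_one_eq_zero
    (S := P1CohomologyPiece 1) rfl
  obtain ⟨e₂, -⟩ := CSl2.exists_linearEquiv_span_singleton hα₀ hspan hε
    (S := P1CohomologyPiece 2) rfl
  have e₃ (k : ℕ) := (CSl2.exists_linearEquiv_of_eq_bot (hv.ext_add_three_eq_zero (k := k))
    (S := P1CohomologyPiece (k + 3)) rfl).some
  obtain ⟨e, he⟩ : ∃ e : ∀ n : ℕ, Ext V V n ≃ₗ[ℂ] P1CohomologyPiece n,
      (e 0 (Ext.mk₀ (𝟙 V)) : DualNumber ℂ) = 1 :=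
    ⟨fun | 0 => e₀ | 1 => e₁ | 2 => e₂ | k + 3 => e₃ k, he₀⟩
  have hmul : ∀ (p q n : ℕ) (hn : p + q = n) (α : Ext V V p) (β : Ext V V q),
      (e n (α.comp β hn) : DualNumber ℂ) = (e p α : DualNumber ℂ) * (e q β : DualNumber ℂ) := by
    intro p q n hn α β
    match p, q, hn, α, β with
    | 0, q, hn, α, β =>
      obtain rfl : q = n := by lia
      obtain ⟨c, rfl⟩ := hv.ext_zero_eq_smul α
      simp [he]
    | p, 0, hn, α, β =>
      obtain rfl : p = n := by lia
      obtain ⟨c, rfl⟩ := hv.ext_zero_eq_smul β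
      simp [he]
    | 1, q, hn, α, β => simp [hv.ext_one_eq_zero α]
    | p, 1, hn, α, β => simp [hv.ext_one_eq_zero β]
    | p + 3, q, hn, α, β => simp [hv.ext_add_three_eq_zero α]
    | p, q + 3, hn, α, β => simp [hv.ext_add_three_eq_zero β]
    | 2, 2, hn, α, β =>
      subst hn
      obtain ⟨c, hc⟩ := Submodule.mem_span_singleton.1 (e 2 α).2
      obtain ⟨d, hd⟩ := Submodule.mem_span_singleton.1 (e 2 β).2
      rw [← hc, ← hd, hv.ext_add_three_eq_zero (k := 1) (α.comp β _)]
      simp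
  refine ⟨fun n => (e n).toAddEquiv, he, fun p q => hmul p q _ rfl, fun n c α => ?_⟩
  have hc : CSl2.scalarHom c V = c • 𝟙 V := rfl
  simp [hc, Ext.mk₀_smul]
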